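/- arXiv:2604.09333 — 2 statements merged into one kernel-verified Lean document; each statement's English description precedes it below -/
import Mathlib

section
/- Let a ∈ ℂ, λ ∈ ℂ∖{0}, and define g(z) := (z−a)^α · exp(λ·(z−a)^{−m}) on ℂ∖{a} (integer powers). Then for every z ≠ a and every integer n ≥ 0, the n-th complex derivative of g satisfies g⁽ⁿ⁾(z) = (−1)ⁿ · (z−a)^{α−n} · Π_n( −λ·(z−a)^{−m} ) · exp(λ·(z−a)^{−m}), where Π_n is evaluated at the complex argument. -/
open Polynomial

/-- One differentiation step for functions of the form
`(z - a) ^ β * P (-lam * (z - a) ^ (-m)) * exp (lam * (z - a) ^ (-m))`. -/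
lemma hasDerivAt_zpow_mul_eval_mul_exp (m : ℕ) (β : ℤ) (P : Polynomial ℂ) (a lam : ℂ)
    {z : ℂ} (hz : z ≠ a) :
    HasDerivAt (fun w : ℂ => (w - a) ^ β * P.eval (-lam * (w - a) ^ (-(m : ℤ))) *
        Complex.exp (lam * (w - a) ^ (-(m : ℤ))))
      (-((z - a) ^ (β - 1) *
        (C (m : ℂ) * X * derivative P + (C (-(β : ℂ)) - C (m : ℂ) * X) * P).eval
          (-lam * (z - a) ^ (-(m : ℤ))) *
        Complex.exp (lam * (z - a) ^ (-(m : ℤ))))) z := by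
  have hza : z - a ≠ 0 := sub_ne_zero.mpr hz
  have hpow (k : ℤ) : HasDerivAt (fun w : ℂ => (w - a) ^ k) (k * (z - a) ^ (k - 1)) z :=
    (hasDerivAt_zpow k (z - a) (Or.inl hza)).comp_sub_const z a
  have heval := HasDerivAt.comp (h₂ := fun x => P.eval x) z
    (P.hasDerivAt (-lam * (z - a) ^ (-(m : ℤ)))) ((hpow (-(m : ℤ))).const_mul (-lam))
  have hexp := ((hpow (-(m : ℤ))).const_mul lam).cexp
  refine (((hpow β).mul heval).mul hexp).congr_deriv ?_
  simp only [Pi.mul_apply, Function.comp_apply, zpow_sub_one₀ hza, eval_add, eval_sub, eval_mul, eval_C, eval_X]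
  push_cast
  ring

/-- With `g(z) = (z−a)^α · exp(λ(z−a)^{−m})`, for every `z ≠ a`
and every `n ≥ 0`:
`g⁽ⁿ⁾(z) = (−1)ⁿ (z−a)^{α−n} Π_n(−λ(z−a)^{−m}) exp(λ(z−a)^{−m})`. -/
theorem reduced_local_model_derivatives
    (m : ℕ) (hm : 1 ≤ m) (α : ℤ)
    (Pn : ℕ → Polynomial ℂ) (hPn0 : Pn 0 = 1)
    (hPn : ∀ n : ℕ, Pn (n + 1) =
      C (m : ℂ) * X * derivative (Pn n) + (C ((n : ℂ) - (α : ℂ)) - C (m : ℂ) * X) * Pn n)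
    (a lam : ℂ) (hlam : lam ≠ 0)
    (g : ℂ → ℂ)
    (hg : ∀ z : ℂ, g z = (z - a) ^ (α : ℤ) * Complex.exp (lam * (z - a) ^ (-(m : ℤ)))) :
    ∀ z : ℂ, z ≠ a → ∀ n : ℕ,
      iteratedDeriv n g z = (-1) ^ n * (z - a) ^ (α - (n : ℤ)) *
        (Pn n).eval (-lam * (z - a) ^ (-(m : ℤ))) *
        Complex.exp (lam * (z - a) ^ (-(m : ℤ))) := by
  intro z hz n
  induction n generalizing z with
  | zero => simp [hg, hPn0]
  | succ n ih =>
    have hev : iteratedDeriv n g =ᶠ[nhds z] fun w => (-1) ^ n * ((w - a) ^ (α - (n : ℤ)) *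
        (Pn n).eval (-lam * (w - a) ^ (-(m : ℤ))) *
        Complex.exp (lam * (w - a) ^ (-(m : ℤ)))) := by
      filter_upwards [isOpen_ne.mem_nhds hz] with w hw
      rw [ih w hw]
      ring
    rw [iteratedDeriv_succ, hev.deriv_eq,
      ((hasDerivAt_zpow_mul_eval_mul_exp m (α - n) (Pn n) a lam hz).const_mul _).deriv, hPn n,
      show α - ((n + 1 : ℕ) : ℤ) = α - n - 1 by push_cast; ring,
      show -((α - n : ℤ) : ℂ) = n - α by push_cast; ring]
    ring
end

section
/- For every x ∈ ℂ and every t ∈ ℂ with |t| < 1, the series ∑_{n≥0} Π_n(x)·tⁿ/n! converges with sum equal to (1−t)^α · exp( x·(1 − (1−t)^{−m}) ), where (1−t)^α denotes the integer power. -/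
open Polynomial

section ShefferFunction

/-- The closed form of the generating function, as a function of `t`. -/
noncomputable def shefferFunction (m : ℕ) (α : ℤ) (x t : ℂ) : ℂ :=
  (1 - t) ^ α * Complex.exp (x * (1 - (1 - t) ^ (-(m : ℤ))))

theorem hasDerivAt_one_sub_zpow (k : ℤ) {t : ℂ} (ht : t ≠ 1) :
    HasDerivAt (fun s : ℂ => (1 - s) ^ k) (-k * (1 - t) ^ k * (1 - t)⁻¹) t := by
  have h1 : (1 : ℂ) - t ≠ 0 := sub_ne_zero.mpr ht.symm
  have h := (hasDerivAt_zpow k (1 - t) (Or.inl h1)).comp t ((hasDerivAt_id t).const_sub 1)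
  refine h.congr_deriv ?_
  rw [zpow_sub_one₀ h1]
  ring

theorem hasDerivAt_shefferFunction (m : ℕ) (α : ℤ) (x : ℂ) {t : ℂ} (ht : t ≠ 1) :
    HasDerivAt (shefferFunction m α x)
      ((-α - m * (x * (1 - t) ^ (-(m : ℤ)))) * (1 - t)⁻¹ * shefferFunction m α x t) t := by
  have h := (hasDerivAt_one_sub_zpow α ht).mul
    (((hasDerivAt_one_sub_zpow (-(m : ℤ)) ht).const_sub 1).const_mul x).cexp
  refine h.congr_deriv ?_
  simp only [shefferFunction]
  push_cast
  ring

theorem iteratedDeriv_shefferFunction (m : ℕ) (α : ℤ) (Pn : ℕ → Polynomial ℂ) (hPn0 : Pn 0 = 1)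
    (hPn : ∀ n : ℕ, Pn (n + 1) =
      C (m : ℂ) * X * derivative (Pn n) + (C ((n : ℂ) - (α : ℂ)) - C (m : ℂ) * X) * Pn n)
    (x : ℂ) (n : ℕ) {t : ℂ} (ht : t ≠ 1) :
    iteratedDeriv n (shefferFunction m α x) t =
      (Pn n).eval (x * (1 - t) ^ (-(m : ℤ))) * (1 - t) ^ (-(n : ℤ)) * shefferFunction m α x t := by
  induction n generalizing t with
  | zero => simp [hPn0]
  | succ n ih =>
    have h1 : (1 : ℂ) - t ≠ 0 := sub_ne_zero.mpr ht.symm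
    have hev : iteratedDeriv n (shefferFunction m α x) =ᶠ[nhds t] fun s =>
        (Pn n).eval (x * (1 - s) ^ (-(m : ℤ))) * (1 - s) ^ (-(n : ℤ)) *
          shefferFunction m α x s := by
      filter_upwards [isOpen_ne.mem_nhds ht] with s hs using ih hs
    have hP := ((Pn n).hasDerivAt (x * (1 - t) ^ (-(m : ℤ)))).comp t
      ((hasDerivAt_one_sub_zpow (-(m : ℤ)) ht).const_mul x)
    have hd := (hP.mul (hasDerivAt_one_sub_zpow (-(n : ℤ)) ht)).mul
      (hasDerivAt_shefferFunction m α x ht)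
    rw [iteratedDeriv_succ, hev.deriv_eq]
    refine hd.deriv.trans ?_
    have hz : (1 - t) ^ (-((n + 1 : ℕ) : ℤ)) = (1 - t) ^ (-(n : ℤ)) * (1 - t)⁻¹ := by
      rw [← zpow_sub_one₀ h1]
      congr 1
      push_cast
      ring
    rw [hz, hPn]
    simp only [eval_add, eval_sub, eval_mul, eval_C, eval_X, Function.comp_apply, Pi.mul_apply]
    push_cast
    ring

end ShefferFunction

/-- For every `x ∈ ℂ` and every `t ∈ ℂ` with `|t| < 1`, the series
`∑_{n≥0} Π_n(x) tⁿ/n!` converges with sum `(1−t)^α · exp( x·(1 − (1−t)^{−m}) )`. -/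
theorem sheffer_generating_function
    (m : ℕ) (hm : 1 ≤ m) (α : ℤ)
    (Pn : ℕ → Polynomial ℂ) (hPn0 : Pn 0 = 1)
    (hPn : ∀ n : ℕ, Pn (n + 1) =
      C (m : ℂ) * X * derivative (Pn n) + (C ((n : ℂ) - (α : ℂ)) - C (m : ℂ) * X) * Pn n) :
    ∀ x t : ℂ, ‖t‖ < 1 →
      HasSum (fun n : ℕ => (Pn n).eval x * t ^ n / (n.factorial : ℂ))
        ((1 - t) ^ (α : ℤ) *
          Complex.exp (x * (1 - (1 - t) ^ (-(m : ℤ))))) := by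
  intro x t ht
  have hdiff : DifferentiableOn ℂ (shefferFunction m α x) (Metric.ball 0 1) := by
    intro s hs
    have hs1 : s ≠ 1 := by
      rintro rfl
      simp at hs
    exact (hasDerivAt_shefferFunction m α x hs1).differentiableAt.differentiableWithinAt
  have h := Complex.hasSum_taylorSeries_on_ball hdiff (z := t) (by simpa using ht)
  refine (congrArg (HasSum · _) (funext fun n => ?_)).mpr h
  rw [iteratedDeriv_shefferFunction m α Pn hPn0 hPn x n zero_ne_one]
  simp only [shefferFunction, sub_zero, one_zpow, mul_one, sub_self, mul_zero, Complex.exp_zero,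
    smul_eq_mul]
  ring
end
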